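/- ∫_0^{π/2} ln(cosh(x/√3) + cos(ln(2 cos x)/√3)) dx = π²/(8√3) - (π/4)·ln(1+√3) + (13π/24)·ln 2. -/

import Mathlib

open Real

/-- The function `z ↦ cos (log (1 + z) / (2 s))`. -/
noncomputable def cosLog (s : ℝ) (z : ℂ) : ℂ :=
  Complex.cos (Complex.log (1 + z) / (2 * s))

lemma one_add_mem_slitPlane {z : ℂ} (hz : ‖z‖ < 1) : 1 + z ∈ Complex.slitPlane := by
  refine Or.inl ?_
  have := (abs_le.1 (Complex.abs_re_le_norm z)).1
  simp only [Complex.add_re, Complex.one_re]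
  linarith

lemma analyticAt_cosLog (s : ℝ) {z : ℂ} (hz : 1 + z ∈ Complex.slitPlane) :
    AnalyticAt ℂ (cosLog s) z := by
  unfold cosLog
  have h : AnalyticAt ℂ (fun w : ℂ => Complex.log (1 + w)) z := AnalyticAt.clog (by fun_prop) hz
  exact (Complex.differentiable_cos.analyticAt _).fun_comp h.div_const

/-- The zeros of `cosLog s` in the unit disc. -/
noncomputable def cosLogZero (s : ℝ) (k : ℕ) : ℝ := 1 - Real.exp (-(π * s * (2 * k + 1)))

lemma cosLogZero_pos {s : ℝ} (hs : 1 ≤ s) (k : ℕ) : 0 < cosLogZero s k := by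
  unfold cosLogZero
  have : 0 < π * s * (2 * k + 1) := by positivity
  have := Real.exp_lt_one_iff.2 (neg_lt_zero.2 this)
  linarith

lemma cosLogZero_lt_one (s : ℝ) (k : ℕ) : cosLogZero s k < 1 := by
  unfold cosLogZero
  linarith [Real.exp_pos (-(π * s * (2 * k + 1)))]

lemma cosLogZero_injective {s : ℝ} (hs : 1 ≤ s) : Function.Injective (cosLogZero s) := by
  intro j k h
  unfold cosLogZero at h
  have h1 := Real.exp_injective (sub_right_injective h)
  have h2 : π * s ≠ 0 := by positivity
  have h3 := mul_left_cancel₀ h2 (neg_injective h1)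
  exact_mod_cast (show (j : ℝ) = k by linarith)

lemma cosLog_eq_zero_iff {s : ℝ} (hs : 1 ≤ s) {z : ℂ} (hz : ‖z‖ < 1) :
    cosLog s z = 0 ↔ ∃ k, z = -(cosLogZero s k : ℂ) := by
  have hs0 : (s : ℂ) ≠ 0 := by
    exact_mod_cast (by positivity : s ≠ 0)
  have hne : 1 + z ≠ 0 := Complex.slitPlane_ne_zero (one_add_mem_slitPlane hz)
  unfold cosLog cosLogZero
  rw [Complex.cos_eq_zero_iff]
  constructor
  · rintro ⟨n, hn⟩
    have hlog : Complex.log (1 + z) = ((π * s * (2 * n + 1) : ℝ) : ℂ) := by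
      push_cast
      field_simp at hn
      linear_combination hn
    have hz' : 1 + z = ((Real.exp (π * s * (2 * n + 1)) : ℝ) : ℂ) := by
      rw [Complex.ofReal_exp, ← hlog, Complex.exp_log hne]
    have hn0 : n < 0 := by
      by_contra! hn0
      have h1 : (0 : ℝ) ≤ n := by exact_mod_cast hn0
      have h2 : 2 < π * s * (2 * n + 1) + 1 := by
        nlinarith [Real.pi_gt_three, mul_nonneg (mul_nonneg Real.pi_pos.le (by linarith : 0 ≤ s)) h1]
      have h3 := Real.add_one_le_exp (π * s * (2 * n + 1))
      have h4 : ‖1 + z‖ ≤ 2 := (norm_add_le _ _).trans (by rw [norm_one]; linarith)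
      rw [hz', Complex.norm_of_nonneg (Real.exp_pos _).le] at h4
      linarith
    obtain ⟨k, rfl⟩ : ∃ k : ℕ, n = -((k : ℤ) + 1) := ⟨(-n - 1).toNat, by omega⟩
    refine ⟨k, ?_⟩
    rw [eq_sub_of_add_eq' hz']
    push_cast
    ring_nf
  · rintro ⟨k, rfl⟩
    refine ⟨-((k : ℤ) + 1), ?_⟩
    have : (1 : ℂ) + -((1 - Real.exp (-(π * s * (2 * k + 1))) : ℝ) : ℂ)
        = ((Real.exp (-(π * s * (2 * k + 1))) : ℝ) : ℂ) := by
      push_cast; ring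
    rw [this, ← Complex.ofReal_log (Real.exp_pos _).le, Real.log_exp]
    push_cast
    field_simp
    ring

lemma deriv_cosLog_ne_zero {s : ℝ} (hs : 1 ≤ s) {z : ℂ} (hz : ‖z‖ < 1) (h : cosLog s z = 0) :
    deriv (cosLog s) z ≠ 0 := by
  have hs0 : (s : ℂ) ≠ 0 := by
    exact_mod_cast (by positivity : s ≠ 0)
  have hsl := one_add_mem_slitPlane hz
  have hne : 1 + z ≠ 0 := Complex.slitPlane_ne_zero hsl
  have hd : HasDerivAt (cosLog s)
      (-Complex.sin (Complex.log (1 + z) / (2 * s)) * (1 / (1 + z) / (2 * s))) z := by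
    unfold cosLog
    exact ((((hasDerivAt_id z).const_add 1).clog hsl).div_const _).ccos
  rw [hd.deriv]
  refine mul_ne_zero (neg_ne_zero.2 fun hsin => ?_) ?_
  swap
  · exact div_ne_zero (one_div_ne_zero hne) (mul_ne_zero two_ne_zero hs0)
  have := Complex.sin_sq_add_cos_sq (Complex.log (1 + z) / (2 * s))
  unfold cosLog at h
  rw [hsin, h] at this
  norm_num at this

open Classical in
lemma divisor_cosLog {s r : ℝ} (hs : 1 ≤ s) (hr1 : |r| < 1) (u : ℂ) :
    MeromorphicOn.divisor (cosLog s) (Metric.closedBall 0 |r|) u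
      = if u ∈ Metric.closedBall (0 : ℂ) |r| ∧ cosLog s u = 0 then 1 else 0 := by
  have han : AnalyticOnNhd ℂ (cosLog s) (Metric.closedBall 0 |r|) := fun z hz =>
    analyticAt_cosLog s (one_add_mem_slitPlane ((mem_closedBall_zero_iff.1 hz).trans_lt hr1))
  by_cases hu : u ∈ Metric.closedBall (0 : ℂ) |r|
  · rw [MeromorphicOn.AnalyticOnNhd.divisor_apply han hu]
    by_cases h0 : cosLog s u = 0
    · rw [(han u hu).analyticOrderAt_eq_one_of_zero_deriv_ne_zero h0
        (deriv_cosLog_ne_zero hs ((mem_closedBall_zero_iff.1 hu).trans_lt hr1) h0)]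
      simp [hu, h0]
    · rw [(han u hu).analyticOrderAt_eq_zero.2 h0]
      simp [h0]
  · rw [Function.locallyFinsuppWithin.apply_eq_zero_of_notMem _ hu]
    simp [hu]

lemma circleAverage_log_norm_cosLog {s r : ℝ} (hs : 1 ≤ s) (hr0 : 0 < r) (hr1 : r < 1) :
    circleAverage (fun z => Real.log ‖cosLog s z‖) 0 r
      = ∑' k, max 0 (Real.log (r / cosLogZero s k)) := by
  classical
  have hr : |r| = r := abs_of_pos hr0
  have han : AnalyticOnNhd ℂ (cosLog s) (Metric.closedBall 0 |r|) := fun z hz =>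
    analyticAt_cosLog s
      (one_add_mem_slitPlane ((mem_closedBall_zero_iff.1 hz).trans_lt (hr.trans_lt hr1)))
  have h0 : cosLog s 0 = 1 := by simp [cosLog]
  rw [han.circleAverage_log_norm hr0.ne' (by simp [h0]), h0, norm_one, Real.log_one, add_zero]
  have hfin := (MeromorphicOn.divisor (cosLog s) (Metric.closedBall 0 |r|)).finiteSupport
    (isCompact_closedBall 0 |r|)
  rw [← tsum_eq_finsum (L := SummationFilter.unconditional ℂ)
    (hfin.subset fun u hu => by
      simp only [Function.mem_support] at hu ⊢
      intro h; simp [h] at hu)]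
  have hinj : Function.Injective fun k => -(cosLogZero s k : ℂ) := fun j k h =>
    cosLogZero_injective hs (by exact_mod_cast neg_injective h)
  rw [← hinj.tsum_eq]
  · refine tsum_congr fun k => ?_
    have hk := cosLogZero_pos hs k
    have hn : ‖-(cosLogZero s k : ℂ)‖ = cosLogZero s k := by
      rw [norm_neg, Complex.norm_of_nonneg hk.le]
    have hz : cosLog s (-(cosLogZero s k : ℂ)) = 0 :=
      (cosLog_eq_zero_iff hs (by rw [hn]; exact cosLogZero_lt_one s k)).2 ⟨k, rfl⟩
    rw [divisor_cosLog hs (by rwa [hr])]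
    simp only [hz, and_true, mem_closedBall_zero_iff, hn, hr, zero_sub, norm_neg,
      ← div_eq_mul_inv]
    split_ifs with h
    · rw [max_eq_right (Real.log_nonneg ((one_le_div hk).2 h))]; simp
    · rw [max_eq_left (Real.log_nonpos (by positivity) ((div_le_one hk).2 (not_le.1 h).le))]; simp
  · intro u hu
    by_contra hcon
    refine hu ?_
    beta_reduce
    rw [divisor_cosLog hs (by rwa [hr]), if_neg, Int.cast_zero, zero_mul]
    rintro ⟨h1, h2⟩
    rw [mem_closedBall_zero_iff, hr] at h1
    obtain ⟨k, hk⟩ := (cosLog_eq_zero_iff hs (h1.trans_lt hr1)).1 h2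
    exact hcon ⟨k, hk.symm⟩

lemma summable_log_cosLogZero {s : ℝ} (hs : 1 ≤ s) :
    Summable fun k => Real.log (cosLogZero s k) := by
  unfold cosLogZero
  simp_rw [sub_eq_add_neg]
  refine Real.summable_log_one_add_of_summable (Summable.neg ?_)
  have hr : Real.exp (-(2 * π * s)) < 1 := Real.exp_lt_one_iff.2 (by
    have : 0 < 2 * π * s := by positivity
    linarith)
  refine ((summable_geometric_of_lt_one (Real.exp_pos _).le hr).mul_left
    (Real.exp (-(π * s)))).congr fun k => ?_
  rw [← Real.exp_nat_mul, ← Real.exp_add]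
  ring_nf

open Filter Topology in
lemma tendsto_circleAverage_log_norm_cosLog {s : ℝ} (hs : 1 ≤ s) :
    Tendsto (fun r => circleAverage (fun z => Real.log ‖cosLog s z‖) 0 r) (𝓝[<] 1)
      (𝓝 (-∑' k, Real.log (cosLogZero s k))) := by
  rw [← tsum_neg]
  have hev : ∀ᶠ r : ℝ in 𝓝[<] 1, 0 < r ∧ r < 1 :=
    (eventually_nhdsWithin_of_eventually_nhds (lt_mem_nhds one_pos)).and self_mem_nhdsWithin
  have key : Tendsto (fun r : ℝ => ∑' k, max 0 (Real.log (r / cosLogZero s k))) (𝓝[<] 1)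
      (𝓝 (∑' k, -Real.log (cosLogZero s k))) := by
    refine tendsto_tsum_of_dominated_convergence (summable_log_cosLogZero hs).neg (fun k => ?_) ?_
    · have hk := cosLogZero_pos hs k
      have h1 : ContinuousAt (fun r : ℝ => max 0 (Real.log (r / cosLogZero s k))) 1 := by
        have : (1 : ℝ) / cosLogZero s k ≠ 0 := by positivity
        fun_prop (disch := assumption)
      have h2 := h1.tendsto
      rw [max_eq_right (Real.log_nonneg ((one_le_div hk).2 (cosLogZero_lt_one s k).le)), one_div,
        Real.log_inv] at h2
      exact h2.mono_left nhdsWithin_le_nhds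
    · filter_upwards [hev] with r hr k
      have hk := cosLogZero_pos hs k
      have h1 := cosLogZero_lt_one s k
      rw [Real.norm_of_nonneg (le_max_left _ _)]
      refine max_le (neg_nonneg.2 (Real.log_nonpos hk.le h1.le)) ?_
      rw [Real.log_div hr.1.ne' hk.ne']
      linarith [Real.log_nonpos hr.1.le hr.2.le]
  refine key.congr' ?_
  filter_upwards [hev] with r hr
  rw [circleAverage_log_norm_cosLog hs hr.1 hr.2]

lemma sq_norm_complex_cos (w : ℂ) :
    ‖Complex.cos w‖ ^ 2 = Real.cos w.re ^ 2 + Real.sinh w.im ^ 2 := by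
  rw [← Complex.normSq_eq_norm_sq, Complex.normSq_apply, Complex.cos_eq]
  simp only [← Complex.ofReal_cos, ← Complex.ofReal_sin, ← Complex.ofReal_cosh,
    ← Complex.ofReal_sinh, Complex.sub_re, Complex.sub_im, Complex.mul_re, Complex.mul_im,
    Complex.ofReal_re, Complex.ofReal_im, Complex.I_re, Complex.I_im]
  ring_nf
  rw [Real.cosh_sq, Real.sin_sq]
  ring

lemma sq_norm_cosLog (s : ℝ) (z : ℂ) :
    ‖cosLog s z‖ ^ 2 = Real.cos (Real.log ‖1 + z‖ / (2 * s)) ^ 2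
      + Real.sinh (Complex.arg (1 + z) / (2 * s)) ^ 2 := by
  have h : (2 : ℂ) * s = ((2 * s : ℝ) : ℂ) := by push_cast; rfl
  rw [cosLog, sq_norm_complex_cos, h, Complex.div_ofReal_re, Complex.div_ofReal_im,
    Complex.log_re, Complex.log_im]

lemma norm_cosLog_le {s : ℝ} (hs : 1 ≤ s) (z : ℂ) : ‖cosLog s z‖ ≤ Real.cosh π := by
  refine abs_le_of_sq_le_sq' ?_ (Real.cosh_pos _).le |>.2
  rw [sq_norm_cosLog]
  have h1 := Real.cos_sq_le_one (Real.log ‖1 + z‖ / (2 * s))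
  have h2 : Real.cosh (Complex.arg (1 + z) / (2 * s)) ≤ Real.cosh π := by
    rw [Real.cosh_le_cosh, abs_div, abs_of_pos Real.pi_pos, abs_of_pos (by positivity : 0 < 2 * s)]
    rw [div_le_iff₀ (by positivity)]
    have := Complex.abs_arg_le_pi (1 + z)
    nlinarith [Real.pi_pos]
  have h3 := pow_le_pow_left₀ (Real.cosh_pos _).le h2 2
  rw [Real.cosh_sq (Complex.arg (1 + z) / (2 * s))] at h3
  linarith

lemma abs_sin_le_norm_cosLog {s r : ℝ} (hs : 1 ≤ s) (hr0 : 1 / 2 ≤ r) (hr1 : r ≤ 1) (θ : ℝ) :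
    |Real.sin θ| ≤ 8 * s * ‖cosLog s (circleMap 0 r θ)‖ := by
  set z := circleMap 0 r θ with hz
  set v := Complex.arg (1 + z) / (2 * s) with hv
  have him : (1 + z).im = r * Real.sin θ := by
    simp [hz, circleMap, Complex.exp_im]
  have hnz : ‖1 + z‖ ≤ 2 := by
    refine (norm_add_le _ _).trans ?_
    rw [norm_one, hz, norm_circleMap_zero, abs_of_nonneg (by linarith)]
    linarith
  have h1 : |Real.sin θ| / 2 ≤ 2 * |Complex.arg (1 + z)| := by
    have h2 : |(1 + z).im| = |Real.sin (Complex.arg (1 + z))| * ‖1 + z‖ := by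
      rw [Complex.sin_arg, abs_div, abs_norm]
      rcases eq_or_ne (1 + z) 0 with h | h
      · simp [h]
      · field_simp [norm_ne_zero_iff.2 h]
    rw [him, abs_mul, abs_of_nonneg (by linarith : 0 ≤ r)] at h2
    have h3 : |Real.sin (Complex.arg (1 + z))| ≤ |Complex.arg (1 + z)| := Real.abs_sin_le_abs
    nlinarith [abs_nonneg (Real.sin θ), abs_nonneg (Real.sin (Complex.arg (1 + z)))]
  have h4 : |Complex.arg (1 + z)| = 2 * s * |v| := by
    rw [hv, abs_div, abs_of_pos (by positivity : 0 < 2 * s)]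
    field_simp
  have h5 : |v| ≤ ‖cosLog s z‖ := by
    refine abs_le_of_sq_le_sq' ?_ (norm_nonneg _) |>.2
    rw [sq_norm_cosLog, ← hv]
    have h6 : |v| ≤ Real.sinh |v| := Real.self_le_sinh_iff.2 (abs_nonneg v)
    have h7 := pow_le_pow_left₀ (abs_nonneg v) h6 2
    rw [← Real.abs_sinh, sq_abs, sq_abs] at h7
    rw [sq_abs]
    nlinarith [sq_nonneg (Real.cos (Real.log ‖1 + z‖ / (2 * s)))]
  nlinarith

lemma abs_log_norm_cosLog_le {s r : ℝ} (hs : 1 ≤ s) (hr0 : 1 / 2 ≤ r) (hr1 : r ≤ 1) {θ : ℝ}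
    (hθ : Real.sin θ ≠ 0) :
    |Real.log ‖cosLog s (circleMap 0 r θ)‖|
      ≤ Real.log (Real.cosh π) + Real.log (8 * s) + |Real.log (Real.sin θ)| := by
  have h1 := abs_sin_le_norm_cosLog hs hr0 hr1 θ
  have hpos : 0 < ‖cosLog s (circleMap 0 r θ)‖ := by
    have := abs_pos.2 hθ
    by_contra! h
    nlinarith
  have h2 := Real.log_le_log hpos (norm_cosLog_le hs (circleMap 0 r θ))
  have h3 := Real.log_le_log (abs_pos.2 hθ) h1
  rw [Real.log_abs, Real.log_mul (by positivity) hpos.ne'] at h3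
  have h4 := Real.log_nonneg (Real.one_le_cosh π)
  have h5 := Real.log_nonneg (by linarith : 1 ≤ 8 * s)
  rw [abs_le]
  constructor <;> linarith [neg_abs_le (Real.log (Real.sin θ)), abs_nonneg (Real.log (Real.sin θ))]

lemma measurable_cosLog (s : ℝ) : Measurable (cosLog s) := by
  unfold cosLog
  exact Complex.measurable_cos.comp
    ((Complex.measurable_log.comp (measurable_const_add 1)).div_const _)

lemma ae_sin_ne_zero : ∀ᵐ θ : ℝ, Real.sin θ ≠ 0 := by
  have : Set.Countable {θ : ℝ | Real.sin θ = 0} := by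
    refine (Set.countable_range fun n : ℤ => (n : ℝ) * π).mono fun θ hθ => ?_
    exact Real.sin_eq_zero_iff.1 hθ
  filter_upwards [MeasureTheory.compl_mem_ae_iff.2 (this.measure_zero MeasureTheory.volume)]
    with θ hθ using hθ

open Filter Topology in
lemma circleAverage_log_norm_cosLog_one {s : ℝ} (hs : 1 ≤ s) :
    circleAverage (fun z => Real.log ‖cosLog s z‖) 0 1 = -∑' k, Real.log (cosLogZero s k) := by
  refine tendsto_nhds_unique ?_ (tendsto_circleAverage_log_norm_cosLog hs)
  have hev : ∀ᶠ r : ℝ in 𝓝[<] 1, 1 / 2 ≤ r ∧ r ≤ 1 := by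
    filter_upwards [eventually_nhdsWithin_of_eventually_nhds
      (lt_mem_nhds (by norm_num : (1 / 2 : ℝ) < 1)), self_mem_nhdsWithin] with r h1 h2
    exact ⟨h1.le, le_of_lt h2⟩
  simp only [circleAverage_def]
  refine Tendsto.const_smul ?_ _
  refine intervalIntegral.tendsto_integral_filter_of_dominated_convergence
    (fun θ => Real.log (Real.cosh π) + Real.log (8 * s) + |Real.log (Real.sin θ)|) ?_ ?_ ?_ ?_
  · refine Eventually.of_forall fun r => Measurable.aestronglyMeasurable ?_
    exact Real.measurable_log.comp
      ((measurable_cosLog s).norm.comp (continuous_circleMap 0 r).measurable)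
  · filter_upwards [hev] with r hr
    filter_upwards [ae_sin_ne_zero] with θ hθ _
    exact abs_log_norm_cosLog_le hs hr.1 hr.2 hθ
  · exact intervalIntegrable_const.add intervalIntegrable_log_sin.abs
  · filter_upwards [ae_sin_ne_zero] with θ hθ _
    have hsl : 1 + circleMap 0 1 θ ∈ Complex.slitPlane :=
      Or.inr (by simpa [circleMap, Complex.exp_im] using hθ)
    have hne : ‖cosLog s (circleMap 0 1 θ)‖ ≠ 0 := fun h => by
      have := abs_sin_le_norm_cosLog hs (by norm_num) le_rfl θ
      rw [h, mul_zero] at this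
      exact hθ (abs_nonpos_iff.1 this)
    have h1 : ContinuousAt (fun r : ℝ => cosLog s (circleMap 0 r θ)) 1 := by
      refine ContinuousAt.comp (g := cosLog s) (analyticAt_cosLog s hsl).continuousAt ?_
      unfold circleMap
      fun_prop
    exact ((h1.norm).log hne).tendsto.mono_left nhdsWithin_le_nhds

lemma norm_cosLog_conj (s : ℝ) {z : ℂ} (hz : ‖z‖ ≤ 1) :
    ‖cosLog s (starRingEnd ℂ z)‖ = ‖cosLog s z‖ := by
  have harg : Complex.arg (1 + z) ≠ π := by
    rw [Ne, Complex.arg_eq_pi_iff]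
    rintro ⟨h, -⟩
    have := (abs_le.1 (Complex.abs_re_le_norm z)).1
    simp only [Complex.add_re, Complex.one_re] at h
    linarith
  have h1 : 1 + starRingEnd ℂ z = starRingEnd ℂ (1 + z) := by simp
  have h2 : starRingEnd ℂ (Complex.log (1 + z)) / (2 * s)
      = starRingEnd ℂ (Complex.log (1 + z) / (2 * s)) := by
    simp [Complex.conj_ofReal, Complex.conj_ofNat]
  rw [cosLog, cosLog, h1, Complex.log_conj _ harg, h2, Complex.cos_conj, RCLike.norm_conj]

lemma intervalIntegrable_log_norm_cosLog {s : ℝ} (hs : 1 ≤ s) (a b : ℝ) :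
    IntervalIntegrable (fun θ => Real.log ‖cosLog s (circleMap 0 1 θ)‖)
      MeasureTheory.volume a b := by
  have hb : IntervalIntegrable (fun θ => Real.log (Real.cosh π) + Real.log (8 * s)
      + |Real.log (Real.sin θ)|) MeasureTheory.volume a b :=
    intervalIntegrable_const.add intervalIntegrable_log_sin.abs
  refine hb.mono_fun' ?_ (MeasureTheory.ae_restrict_of_ae ?_)
  · exact (Real.measurable_log.comp
      ((measurable_cosLog s).norm.comp (continuous_circleMap 0 1).measurable)).aestronglyMeasurable
  · filter_upwards [ae_sin_ne_zero] with θ hθ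
    exact abs_log_norm_cosLog_le hs (by norm_num) le_rfl hθ

lemma integral_log_norm_cosLog {s : ℝ} (hs : 1 ≤ s) :
    ∫ x in (0 : ℝ)..(π / 2), Real.log ‖cosLog s (circleMap 0 1 (2 * x))‖
      = -(π / 2) * ∑' k, Real.log (cosLogZero s k) := by
  have h := circleAverage_log_norm_cosLog_one hs
  set g : ℝ → ℝ := fun θ => Real.log ‖cosLog s (circleMap 0 1 θ)‖ with hg
  have hii (a b : ℝ) := intervalIntegrable_log_norm_cosLog hs a b
  have hsymm (θ : ℝ) : g (2 * π - θ) = g θ := by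
    have : circleMap 0 1 (2 * π - θ) = starRingEnd ℂ (circleMap 0 1 θ) := by
      simp only [circleMap, zero_add, Complex.ofReal_one, one_mul, ← Complex.exp_conj, map_mul,
        Complex.conj_ofReal, Complex.conj_I]
      push_cast
      rw [show (2 * (π : ℂ) - θ) * Complex.I = θ * -Complex.I + 2 * π * Complex.I by ring,
        Complex.exp_add, Complex.exp_two_pi_mul_I, mul_one]
    simp only [hg]
    rw [this, norm_cosLog_conj s (by simp)]
  have h2 : ∫ θ in π..(2 * π), g θ = ∫ θ in (0 : ℝ)..π, g θ := by
    have := intervalIntegral.integral_comp_sub_left (a := 0) (b := π) g (2 * π)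
    simp only [hsymm] at this
    rw [this]
    congr 1 <;> ring
  rw [circleAverage_def, ← intervalIntegral.integral_add_adjacent_intervals (hii 0 π) (hii π _),
    h2, smul_eq_mul] at h
  have h3 : ∫ x in (0 : ℝ)..(π / 2), g (2 * x) = 2⁻¹ * ∫ θ in (0 : ℝ)..π, g θ := by
    rw [intervalIntegral.integral_comp_mul_left g two_ne_zero, smul_eq_mul, mul_zero,
      mul_div_cancel₀ π two_ne_zero]
  rw [h3, neg_mul, ← mul_neg, ← h]
  field_simp
  ring

lemma cosh_add_cos_eq_sq_norm_cosLog (s : ℝ) {x : ℝ} (hx0 : 0 < x) (hx1 : x < π / 2) :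
    Real.cosh (x / s) + Real.cos (Real.log (2 * Real.cos x) / s)
      = 2 * ‖cosLog s (circleMap 0 1 (2 * x))‖ ^ 2 := by
  have hc : 0 < 2 * Real.cos x :=
    mul_pos two_pos (Real.cos_pos_of_mem_Ioo ⟨by linarith, hx1⟩)
  have h1 : 1 + circleMap 0 1 (2 * x)
      = ((2 * Real.cos x : ℝ) : ℂ) * (Complex.cos x + Complex.sin x * Complex.I) := by
    simp only [circleMap, zero_add, Complex.ofReal_one, one_mul]
    push_cast
    rw [Complex.exp_mul_I, Complex.cos_two_mul, Complex.sin_two_mul]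
    ring
  have h2 : Complex.arg (1 + circleMap 0 1 (2 * x)) = x := by
    rw [h1, Complex.arg_mul_cos_add_sin_mul_I hc ⟨by linarith, by linarith⟩]
  have h3 : ‖1 + circleMap 0 1 (2 * x)‖ = 2 * Real.cos x := by
    rw [h1, norm_mul, Complex.norm_of_nonneg hc.le, ← Complex.exp_mul_I,
      Complex.norm_exp_ofReal_mul_I, mul_one]
  rw [sq_norm_cosLog, h2, h3, mul_add, Real.cos_sq]
  have h4 : Real.cosh (x / s) = 1 + 2 * Real.sinh (x / (2 * s)) ^ 2 := by
    rw [show x / s = 2 * (x / (2 * s)) by ring, Real.cosh_two_mul, Real.cosh_sq]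
    ring
  rw [h4, show 2 * (Real.log (2 * Real.cos x) / (2 * s)) = Real.log (2 * Real.cos x) / s by ring]
  ring

/-- Jensen's formula for `cosLog s`, in real form. -/
theorem integral_log_cosh_add_cos {s : ℝ} (hs : 1 ≤ s) :
    ∫ x in (0 : ℝ)..(π / 2),
        Real.log (Real.cosh (x / s) + Real.cos (Real.log (2 * Real.cos x) / s))
      = π / 2 * Real.log 2 - π * ∑' k, Real.log (cosLogZero s k) := by
  have h1 : ∫ x in (0 : ℝ)..(π / 2),
        Real.log (Real.cosh (x / s) + Real.cos (Real.log (2 * Real.cos x) / s))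
      = ∫ x in (0 : ℝ)..(π / 2),
        (Real.log 2 + 2 * Real.log ‖cosLog s (circleMap 0 1 (2 * x))‖) := by
    refine intervalIntegral.integral_congr_ae ?_
    filter_upwards [MeasureTheory.volume.ae_ne (π / 2)] with x hne hx
    rw [Set.uIoc_of_le (by positivity)] at hx
    have hx1 : x < π / 2 := lt_of_le_of_ne hx.2 hne
    have hsin : 0 < Real.sin (2 * x) :=
      Real.sin_pos_of_pos_of_lt_pi (by linarith [hx.1]) (by linarith)
    have h0 : ‖cosLog s (circleMap 0 1 (2 * x))‖ ≠ 0 := fun h => by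
      have := abs_sin_le_norm_cosLog hs (by norm_num) le_rfl (2 * x)
      rw [h, mul_zero] at this
      exact hsin.ne' (abs_nonpos_iff.1 this)
    rw [cosh_add_cos_eq_sq_norm_cosLog s hx.1 hx1, Real.log_mul two_ne_zero (pow_ne_zero 2 h0),
      Real.log_pow]
    push_cast
    rfl
  have h2 : IntervalIntegrable (fun x => Real.log ‖cosLog s (circleMap 0 1 (2 * x))‖)
      MeasureTheory.volume 0 (π / 2) := by
    have := (intervalIntegrable_log_norm_cosLog hs 0 π).comp_mul_left (c := 2)
    simpa using this
  rw [h1, intervalIntegral.integral_add intervalIntegrable_const (h2.const_mul 2),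
    intervalIntegral.integral_const_mul, integral_log_norm_cosLog hs,
    intervalIntegral.integral_const, smul_eq_mul]
  ring

lemma tendsto_prod_one_add {f : ℕ → ℝ} (hf : Summable f) (hpos : ∀ j, 0 < 1 + f j) :
    Filter.Tendsto (fun N => ∏ j ∈ Finset.range N, (1 + f j)) Filter.atTop
      (nhds (Real.exp (∑' j, Real.log (1 + f j)))) := by
  have h := (Real.continuous_exp.tendsto _).comp
    (Real.summable_log_one_add_of_summable hf).hasSum.tendsto_sum_nat
  refine h.congr fun N => ?_
  simp only [Function.comp_apply, Real.exp_sum, Real.exp_log (hpos _)]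

/-- The product `∏_{k < n} (1 - q ^ (2 k + 2))`. -/
noncomputable def evenProd (q : ℝ) (n : ℕ) : ℝ := ∏ k ∈ Finset.range n, (1 - q ^ (2 * k + 2))

/-- The inverse of `evenProd q n`, extended by zero to negative integers. -/
noncomputable def evenProdInv (q : ℝ) (n : ℤ) : ℝ := if n < 0 then 0 else (evenProd q n.toNat)⁻¹

lemma one_sub_pow_pos {q : ℝ} (hq0 : 0 < q) (hq1 : q < 1) (k : ℕ) : 0 < 1 - q ^ (k + 1) := by
  exact sub_pos.2 (pow_lt_one₀ hq0.le hq1 k.succ_ne_zero)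

lemma evenProd_pos {q : ℝ} (hq0 : 0 < q) (hq1 : q < 1) (n : ℕ) : 0 < evenProd q n :=
  Finset.prod_pos fun k _ => one_sub_pow_pos hq0 hq1 (2 * k + 1)

lemma evenProd_antitone {q : ℝ} (hq0 : 0 < q) (hq1 : q < 1) :
    Antitone (evenProd q) := antitone_nat_of_succ_le fun n => by
  rw [evenProd, Finset.prod_range_succ]
  exact mul_le_of_le_one_right (evenProd_pos hq0 hq1 n).le (by linarith [pow_pos hq0 (2 * n + 2)])

lemma evenProd_le_one {q : ℝ} (hq0 : 0 < q) (hq1 : q < 1) (n : ℕ) : evenProd q n ≤ 1 := by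
  simpa [evenProd] using evenProd_antitone hq0 hq1 n.zero_le

lemma evenProdInv_sub_one {q : ℝ} (hq0 : 0 < q) (hq1 : q < 1) (n : ℤ) :
    evenProdInv q (n - 1) = (1 - q ^ (2 * n)) * evenProdInv q n := by
  rcases lt_trichotomy n 0 with h | rfl | h
  · simp [evenProdInv, h, show n - 1 < 0 by omega]
  · simp [evenProdInv]
  · obtain ⟨k, rfl⟩ : ∃ k : ℕ, n = k + 1 := ⟨(n - 1).toNat, by omega⟩
    have h1 : ((k : ℤ) + 1).toNat = k + 1 := by omega
    have h2 := one_sub_pow_pos hq0 hq1 (2 * k + 1)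
    have h3 : q ^ (2 * ((k : ℤ) + 1)) = q ^ (2 * k + 2) := by
      rw [← zpow_natCast]; push_cast; ring_nf
    simp only [evenProdInv, add_sub_cancel_right, h1, Int.toNat_natCast, h3,
      show ¬ ((k : ℤ) < 0) by omega, show ¬ ((k : ℤ) + 1 < 0) by omega, if_false]
    rw [evenProd, evenProd, Finset.prod_range_succ, mul_inv]
    field_simp

/-- The finite form of the Jacobi triple product. -/
lemma hasSum_finite_triple_product {q : ℝ} (hq0 : 0 < q) (hq1 : q < 1)
    {z : ℝ} (hz : z ≠ 0) (N : ℕ) :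
    HasSum (fun n : ℤ => evenProd q (2 * N) * evenProdInv q (N - n) * evenProdInv q (N + n)
        * q ^ (n ^ 2) * z ^ n)
      (∏ j ∈ Finset.range N, ((1 + z * q ^ (2 * j + 1)) * (1 + z⁻¹ * q ^ (2 * j + 1)))) := by
  induction N with
  | zero =>
    have h := hasSum_single (f := fun n : ℤ => evenProd q (2 * 0) * evenProdInv q ((0 : ℕ) - n)
      * evenProdInv q ((0 : ℕ) + n) * q ^ (n ^ 2) * z ^ n) 0 (fun n hn => by
        rcases lt_or_gt_of_ne hn with h | h <;> simp [evenProdInv, h])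
    simpa [evenProdInv, evenProd] using h
  | succ N ih =>
    set F : ℤ → ℝ := fun n => evenProd q (2 * N) * evenProdInv q (N - n) * evenProdInv q (N + n)
        * q ^ (n ^ 2) * z ^ n with hF
    rw [Finset.prod_range_succ]
    set S := ∏ j ∈ Finset.range N, ((1 + z * q ^ (2 * j + 1)) * (1 + z⁻¹ * q ^ (2 * j + 1)))
    have ih1 : HasSum (fun n => F (n - 1)) S :=
      (Equiv.subRight (1 : ℤ)).hasSum_iff (f := F) |>.2 ih
    have ih2 : HasSum (fun n => F (n + 1)) S :=
      (Equiv.addRight (1 : ℤ)).hasSum_iff (f := F) |>.2 ih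
    convert! ((ih.mul_left (1 + q ^ (4 * N + 2))).add (ih1.mul_left (z * q ^ (2 * N + 1)))).add
      (ih2.mul_left (z⁻¹ * q ^ (2 * N + 1))) using 1
    · funext n
      simp only [hF]
      have hY : q ^ n ≠ 0 := (zpow_pos hq0 n).ne'
      have e1 : evenProdInv q ((N : ℤ) - n)
          = (1 - q ^ 2 * (q ^ N) ^ 2 / (q ^ n) ^ 2) * evenProdInv q (N + 1 - n) := by
        have := evenProdInv_sub_one hq0 hq1 (N + 1 - n)
        rw [show (N : ℤ) + 1 - n - 1 = N - n by ring] at this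
        rw [this, show 2 * ((N : ℤ) + 1 - n) = 2 + N * 2 - n * 2 by ring, zpow_sub₀ hq0.ne',
          zpow_add₀ hq0.ne', zpow_mul, zpow_mul]
        norm_cast
      have e2 : evenProdInv q ((N : ℤ) + n)
          = (1 - q ^ 2 * (q ^ N) ^ 2 * (q ^ n) ^ 2) * evenProdInv q (N + 1 + n) := by
        have := evenProdInv_sub_one hq0 hq1 (N + 1 + n)
        rw [show (N : ℤ) + 1 + n - 1 = N + n by ring] at this
        rw [this, show 2 * ((N : ℤ) + 1 + n) = 2 + N * 2 + n * 2 by ring, zpow_add₀ hq0.ne',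
          zpow_add₀ hq0.ne', zpow_mul, zpow_mul]
        norm_cast
      have e3 : evenProdInv q ((N : ℤ) - (n + 1))
          = (1 - (q ^ N) ^ 2 / (q ^ n) ^ 2) * evenProdInv q (N - n) := by
        have := evenProdInv_sub_one hq0 hq1 (N - n)
        rw [show (N : ℤ) - n - 1 = N - (n + 1) by ring] at this
        rw [this, show 2 * ((N : ℤ) - n) = N * 2 - n * 2 by ring, zpow_sub₀ hq0.ne',
          zpow_mul, zpow_mul]
        norm_cast
      have e4 : evenProdInv q ((N : ℤ) + (n - 1))
          = (1 - (q ^ N) ^ 2 * (q ^ n) ^ 2) * evenProdInv q (N + n) := by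
        have := evenProdInv_sub_one hq0 hq1 (N + n)
        rw [show (N : ℤ) + n - 1 = N + (n - 1) by ring] at this
        rw [this, show 2 * ((N : ℤ) + n) = N * 2 + n * 2 by ring, zpow_add₀ hq0.ne',
          zpow_mul, zpow_mul]
        norm_cast
      have e5 : q ^ ((n - 1) ^ 2) = q ^ (n ^ 2) * q / (q ^ n) ^ 2 := by
        rw [show (n - 1) ^ 2 = n ^ 2 + 1 - n * 2 by ring, zpow_sub₀ hq0.ne', zpow_add₀ hq0.ne',
          zpow_mul, zpow_one]
        norm_cast
      have e6 : q ^ ((n + 1) ^ 2) = q ^ (n ^ 2) * q * (q ^ n) ^ 2 := by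
        rw [show (n + 1) ^ 2 = n ^ 2 + 1 + n * 2 by ring, zpow_add₀ hq0.ne', zpow_add₀ hq0.ne',
          zpow_mul, zpow_one]
        norm_cast
      have e7 : evenProd q (2 * (N + 1))
          = evenProd q (2 * N) * (1 - q ^ (4 * N + 2)) * (1 - q ^ (4 * N + 4)) := by
        rw [show 2 * (N + 1) = 2 * N + 1 + 1 by ring, evenProd, evenProd, Finset.prod_range_succ,
          Finset.prod_range_succ]
        ring_nf
      have e8 : q ^ (4 * N + 2) = (q ^ N) ^ 4 * q ^ 2 := by ring
      have e9 : q ^ (4 * N + 4) = (q ^ N) ^ 4 * q ^ 4 := by ring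
      have e10 : q ^ (2 * N + 1) = (q ^ N) ^ 2 * q := by ring
      have e11 : (N : ℤ) - (n - 1) = N + 1 - n := by ring
      have e12 : (N : ℤ) + (n + 1) = N + 1 + n := by ring
      push_cast
      rw [e3, e4, e5, e6, e7, e8, e9, e10, e11, e12, e1, e2, zpow_sub_one₀ hz, zpow_add_one₀ hz]
      field_simp
      ring
    · field_simp
      ring

/-- The limit of `evenProd q`. -/
lemma exists_tendsto_evenProd {q : ℝ} (hq0 : 0 < q) (hq1 : q < 1) :
    ∃ P, 0 < P ∧ Filter.Tendsto (evenProd q) Filter.atTop (nhds P) := by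
  have hsum : Summable fun j : ℕ => -q ^ (2 * j + 2) :=
    ((summable_geometric_of_lt_one hq0.le hq1).comp_injective
      (i := fun j : ℕ => 2 * j + 2) (fun a b h => by simpa using h)).neg
  have hpos (j : ℕ) : 0 < 1 + -q ^ (2 * j + 2) := by
    rw [← sub_eq_add_neg]
    exact one_sub_pow_pos hq0 hq1 (2 * j + 1)
  refine ⟨_, Real.exp_pos _, (tendsto_prod_one_add hsum hpos).congr fun n => ?_⟩
  simp [evenProd, sub_eq_add_neg]

open Filter Topology in
/-- The Jacobi triple product. -/
lemma tendsto_triple_product {q : ℝ} (hq0 : 0 < q) (hq1 : q < 1) {z P : ℝ} (hz : z ≠ 0) (hP : 0 < P)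
    (hPt : Tendsto (evenProd q) atTop (𝓝 P)) (hsum : Summable fun n : ℤ => q ^ (n ^ 2) * z ^ n) :
    Tendsto (fun N =>
        ∏ j ∈ Finset.range N, ((1 + z * q ^ (2 * j + 1)) * (1 + z⁻¹ * q ^ (2 * j + 1))))
      atTop (𝓝 (P⁻¹ * ∑' n : ℤ, q ^ (n ^ 2) * z ^ n)) := by
  have hle (n : ℕ) : P ≤ evenProd q n := (evenProd_antitone hq0 hq1).le_of_tendsto hPt n
  have hinv0 (n : ℤ) : 0 ≤ evenProdInv q n := by
    unfold evenProdInv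
    split_ifs
    · rfl
    · exact inv_nonneg.2 (evenProd_pos hq0 hq1 _).le
  have hinv (n : ℤ) : evenProdInv q n ≤ P⁻¹ := by
    unfold evenProdInv
    split_ifs
    · positivity
    · exact inv_anti₀ hP (hle _)
  have hlim : Tendsto (evenProdInv q) atTop (𝓝 P⁻¹) := by
    have h1 : Tendsto (fun n : ℤ => n.toNat) atTop atTop :=
      tendsto_atTop.2 fun b => by
        filter_upwards [eventually_ge_atTop (b : ℤ)] with n hn
        omega
    refine ((hPt.comp h1).inv₀ hP.ne').congr' ?_
    filter_upwards [eventually_ge_atTop 0] with n hn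
    simp [evenProdInv, not_lt.2 hn]
  rw [← tsum_mul_left]
  simp_rw [fun N => ((hasSum_finite_triple_product hq0 hq1 hz N).tsum_eq).symm]
  refine tendsto_tsum_of_dominated_convergence (hsum.norm.mul_left (P⁻¹ * P⁻¹)) (fun n => ?_)
    (Eventually.of_forall fun N n => ?_)
  · have hN : Tendsto (fun N : ℕ => (N : ℤ)) atTop atTop := tendsto_natCast_atTop_atTop
    have h1 := hPt.comp (tendsto_id.const_mul_atTop' (two_pos : 0 < 2))
    have h2 := hlim.comp (tendsto_atTop_add_const_right atTop (-n) hN)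
    have h3 := hlim.comp (tendsto_atTop_add_const_right atTop n hN)
    have := (((h1.mul h2).mul h3).mul_const (q ^ (n ^ 2))).mul_const (z ^ n)
    rw [mul_inv_cancel₀ hP.ne', one_mul, mul_assoc] at this
    exact this
  · rw [mul_assoc (_ * _ * _), norm_mul]
    refine mul_le_mul_of_nonneg_right ?_ (norm_nonneg _)
    have h1 := evenProd_pos hq0 hq1 (2 * N)
    have h2 := hinv0 (N - n)
    have h3 := hinv0 (N + n)
    rw [Real.norm_of_nonneg (by positivity)]
    refine mul_le_mul ?_ (hinv _) h3 (by positivity)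
    calc evenProd q (2 * N) * evenProdInv q (N - n) ≤ 1 * P⁻¹ :=
          mul_le_mul (evenProd_le_one hq0 hq1 _) (hinv _) h2 zero_le_one
      _ = P⁻¹ := one_mul _

/-- The theta series `∑ exp (-c (n + a) ^ 2)`. -/
noncomputable def shiftTheta (a c : ℝ) : ℝ := ∑' n : ℤ, Real.exp (-c * (n + a) ^ 2)

/-- The theta series `∑ (-1) ^ n exp (-c n ^ 2)`. -/
noncomputable def altTheta (c : ℝ) : ℝ := ∑' n : ℤ, (-1) ^ n * Real.exp (-c * n ^ 2)

lemma summable_exp_quadratic {c : ℝ} (hc : 0 < c) (d : ℝ) :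
    Summable fun n : ℤ => Real.exp (-c * n ^ 2 + d * n) := by
  have h := ((summable_jacobiTheta₂_term_iff (-(d / (2 * π) : ℝ) * Complex.I)
    ((c / π : ℝ) * Complex.I)).2 (by simp; positivity)).norm
  refine h.congr fun n => ?_
  rw [norm_jacobiTheta₂_term]
  congr 1
  simp only [Complex.mul_im, Complex.neg_re, Complex.neg_im, Complex.ofReal_re, Complex.ofReal_im,
    Complex.I_re, Complex.I_im]
  field_simp
  ring

lemma summable_shiftTheta (a : ℝ) {c : ℝ} (hc : 0 < c) :
    Summable fun n : ℤ => Real.exp (-c * (n + a) ^ 2) := by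
  refine ((summable_exp_quadratic hc (-2 * c * a)).mul_left (Real.exp (-c * a ^ 2))).congr
    fun n => ?_
  rw [← Real.exp_add]
  ring_nf

lemma summable_altTheta {c : ℝ} (hc : 0 < c) :
    Summable fun n : ℤ => (-1) ^ n * Real.exp (-c * n ^ 2) := by
  refine Summable.of_norm ((summable_shiftTheta 0 hc).congr fun n => ?_)
  rw [norm_mul, Real.norm_eq_abs, abs_neg_one_zpow, Real.norm_of_nonneg (Real.exp_pos _).le,
    add_zero, one_mul]

lemma shiftTheta_pos (a : ℝ) {c : ℝ} (hc : 0 < c) : 0 < shiftTheta a c :=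
  (summable_shiftTheta a hc).tsum_pos (fun _ => (Real.exp_pos _).le) 0 (Real.exp_pos _)

lemma shiftTheta_add_one (a c : ℝ) : shiftTheta (a + 1) c = shiftTheta a c := by
  unfold shiftTheta
  rw [← (Equiv.addRight (1 : ℤ)).tsum_eq fun n : ℤ => Real.exp (-c * (n + a) ^ 2)]
  refine tsum_congr fun n => ?_
  rw [Equiv.coe_addRight]
  push_cast
  ring_nf

/-- Split a double series according to whether the indices have the same parity. -/
lemma tsum_prod_parity {f : ℤ × ℤ → ℝ} (hf : Summable f) :
    ∑' p, f p = ∑' p : ℤ × ℤ, f (p.1 + p.2, p.1 - p.2)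
      + ∑' p : ℤ × ℤ, f (p.1 + p.2 + 1, p.1 - p.2) := by
  have h0 : Function.Injective fun p : ℤ × ℤ => (p.1 + p.2, p.1 - p.2) := by
    rintro ⟨a, b⟩ ⟨c, d⟩ h
    simp only [Prod.mk.injEq] at h ⊢
    omega
  have h1 : Function.Injective fun p : ℤ × ℤ => (p.1 + p.2 + 1, p.1 - p.2) := by
    rintro ⟨a, b⟩ ⟨c, d⟩ h
    simp only [Prod.mk.injEq] at h ⊢
    omega
  have hcompl : IsCompl (Set.range fun p : ℤ × ℤ => (p.1 + p.2, p.1 - p.2))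
      (Set.range fun p : ℤ × ℤ => (p.1 + p.2 + 1, p.1 - p.2)) := by
    suffices h : (Set.range fun p : ℤ × ℤ => (p.1 + p.2 + 1, p.1 - p.2))
        = (Set.range fun p : ℤ × ℤ => (p.1 + p.2, p.1 - p.2))ᶜ by
      rw [h]
      exact isCompl_compl
    ext ⟨m, n⟩
    have e0 : (m, n) ∈ (Set.range fun p : ℤ × ℤ => (p.1 + p.2, p.1 - p.2)) ↔ (m + n) % 2 = 0 := by
      constructor
      · rintro ⟨⟨a, b⟩, h⟩
        simp only [Prod.mk.injEq] at h
        omega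
      · intro h
        exact ⟨((m + n) / 2, (m - n) / 2), by simp only [Prod.mk.injEq]; omega⟩
    have e1 : (m, n) ∈ (Set.range fun p : ℤ × ℤ => (p.1 + p.2 + 1, p.1 - p.2))
        ↔ (m + n) % 2 = 1 := by
      constructor
      · rintro ⟨⟨a, b⟩, h⟩
        simp only [Prod.mk.injEq] at h
        omega
      · intro h
        exact ⟨((m + n - 1) / 2, (m - n - 1) / 2), by simp only [Prod.mk.injEq]; omega⟩
    rw [Set.mem_compl_iff, e0, e1]
    omega
  exact (HasSum.add_isCompl hcompl (h0.hasSum_range_iff.2 (hf.comp_injective h0).hasSum)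
    (h1.hasSum_range_iff.2 (hf.comp_injective h1).hasSum)).tsum_eq

lemma shiftTheta_mul_shiftTheta (a b : ℝ) {c d : ℝ} (hc : 0 < c) (hd : 0 < d) :
    shiftTheta a c * shiftTheta b d
      = ∑' p : ℤ × ℤ, Real.exp (-c * (p.1 + a) ^ 2 - d * (p.2 + b) ^ 2) := by
  unfold shiftTheta
  rw [tsum_mul_tsum_of_summable_norm (summable_shiftTheta a hc).norm (summable_shiftTheta b hd).norm]
  refine tsum_congr fun p => ?_
  rw [← Real.exp_add]
  ring_nf

lemma shiftTheta_mul_parity (a b : ℝ) {c d : ℝ} (hc : 0 < c) (hd : 0 < d) :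
    shiftTheta a c * shiftTheta b d
      = ∑' p : ℤ × ℤ, Real.exp (-c * (p.1 + p.2 + a) ^ 2 - d * (p.1 - p.2 + b) ^ 2)
        + ∑' p : ℤ × ℤ, Real.exp (-c * (p.1 + p.2 + 1 + a) ^ 2 - d * (p.1 - p.2 + b) ^ 2) := by
  have hs := summable_mul_of_summable_norm (summable_shiftTheta a hc).norm
    (summable_shiftTheta b hd).norm
  unfold shiftTheta
  rw [tsum_mul_tsum_of_summable_norm (summable_shiftTheta a hc).norm (summable_shiftTheta b hd).norm,
    tsum_prod_parity hs]
  congr 1 <;> refine tsum_congr fun p => ?_ <;> rw [← Real.exp_add] <;> push_cast <;> ring_nf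

lemma altTheta_mul_parity {c d : ℝ} (hc : 0 < c) (hd : 0 < d) :
    altTheta c * altTheta d
      = ∑' p : ℤ × ℤ, Real.exp (-c * (p.1 + p.2) ^ 2 - d * (p.1 - p.2) ^ 2)
        - ∑' p : ℤ × ℤ, Real.exp (-c * (p.1 + p.2 + 1) ^ 2 - d * (p.1 - p.2) ^ 2) := by
  have hs := summable_mul_of_summable_norm (summable_altTheta hc).norm (summable_altTheta hd).norm
  unfold altTheta
  rw [tsum_mul_tsum_of_summable_norm (summable_altTheta hc).norm (summable_altTheta hd).norm,
    tsum_prod_parity hs, sub_eq_add_neg, ← tsum_neg]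
  have hm (u v : ℤ) (x y : ℝ) : (-1 : ℝ) ^ u * Real.exp x * ((-1) ^ v * Real.exp y)
      = (-1) ^ (u + v) * Real.exp (x + y) := by
    rw [zpow_add₀ (by norm_num), Real.exp_add]; ring
  congr 1 <;> refine tsum_congr fun p => ?_ <;> rw [hm]
  · rw [Even.neg_one_zpow ⟨p.1, by ring⟩, one_mul]
    push_cast
    ring_nf
  · rw [Odd.neg_one_zpow ⟨p.1, by ring⟩, neg_one_mul]
    push_cast
    ring_nf

lemma shiftTheta_zero_sq_add {c : ℝ} (hc : 0 < c) :
    shiftTheta 0 c ^ 2 = shiftTheta 0 (2 * c) ^ 2 + shiftTheta (1 / 2) (2 * c) ^ 2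
      ∧ altTheta c ^ 2 = shiftTheta 0 (2 * c) ^ 2 - shiftTheta (1 / 2) (2 * c) ^ 2 := by
  have h2 : 0 < 2 * c := by positivity
  have e0 : ∑' p : ℤ × ℤ, Real.exp (-c * (p.1 + p.2) ^ 2 - c * (p.1 - p.2) ^ 2)
      = shiftTheta 0 (2 * c) ^ 2 := by
    rw [sq, shiftTheta_mul_shiftTheta _ _ h2 h2]
    refine tsum_congr fun p => ?_
    ring_nf
  have e1 : ∑' p : ℤ × ℤ, Real.exp (-c * (p.1 + p.2 + 1) ^ 2 - c * (p.1 - p.2) ^ 2)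
      = shiftTheta (1 / 2) (2 * c) ^ 2 := by
    rw [sq, shiftTheta_mul_shiftTheta _ _ h2 h2]
    refine tsum_congr fun p => ?_
    ring_nf
  rw [sq, sq (altTheta c), shiftTheta_mul_parity 0 0 hc hc, altTheta_mul_parity hc hc, ← e0, ← e1]
  simp only [add_zero, and_self]

lemma shiftTheta_half_sq {c : ℝ} (hc : 0 < c) :
    shiftTheta (1 / 2) c ^ 2 = 2 * (shiftTheta (1 / 2) (2 * c) * shiftTheta 0 (2 * c)) := by
  have h2 : 0 < 2 * c := by positivity
  rw [sq, shiftTheta_mul_parity _ _ hc hc, two_mul (_ * _)]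
  congr 1
  · rw [shiftTheta_mul_shiftTheta _ _ h2 h2]
    refine tsum_congr fun p => ?_
    ring_nf
  · rw [← shiftTheta_add_one 0, mul_comm, shiftTheta_mul_shiftTheta _ _ h2 h2]
    refine tsum_congr fun p => ?_
    ring_nf

/-- Jacobi's quartic identity. -/
lemma shiftTheta_zero_pow_four {c : ℝ} (hc : 0 < c) :
    shiftTheta 0 c ^ 4 = shiftTheta (1 / 2) c ^ 4 + altTheta c ^ 4 := by
  obtain ⟨h1, h2⟩ := shiftTheta_zero_sq_add hc
  have h3 := shiftTheta_half_sq hc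
  linear_combination (shiftTheta 0 c ^ 2 + (shiftTheta 0 (2 * c) ^ 2
    + shiftTheta (1 / 2) (2 * c) ^ 2)) * h1 - (altTheta c ^ 2 + (shiftTheta 0 (2 * c) ^ 2
    - shiftTheta (1 / 2) (2 * c) ^ 2)) * h2 - (shiftTheta (1 / 2) c ^ 2
    + 2 * (shiftTheta (1 / 2) (2 * c) * shiftTheta 0 (2 * c))) * h3

/-- The modular equation of degree three for theta series. -/
lemma shiftTheta_zero_mul_three {c : ℝ} (hc : 0 < c) :
    shiftTheta 0 c * shiftTheta 0 (3 * c)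
      = altTheta c * altTheta (3 * c) + shiftTheta (1 / 2) c * shiftTheta (1 / 2) (3 * c) := by
  have h3 : 0 < 3 * c := by positivity
  rw [shiftTheta_mul_parity 0 0 hc h3, altTheta_mul_parity hc h3, shiftTheta_mul_parity _ _ hc h3]
  simp only [add_zero]
  set O : ℤ × ℤ → ℝ := fun p => Real.exp (-c * (p.1 + p.2 + 1) ^ 2 - 3 * c * (p.1 - p.2) ^ 2)
    with hO
  let e0 : ℤ × ℤ ≃ ℤ × ℤ :=
    ⟨fun p => (p.1, p.1 - p.2), fun p => (p.1, p.1 - p.2), fun p => by simp, fun p => by simp⟩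
  let e1 : ℤ × ℤ ≃ ℤ × ℤ :=
    ⟨fun p => (p.2, p.2 - p.1 - 1), fun p => (p.1 - p.2 - 1, p.1),
      fun p => Prod.ext (by ring) rfl, fun p => Prod.ext rfl (by ring)⟩
  have h0 : ∑' p : ℤ × ℤ, Real.exp (-c * (p.1 + p.2 + 1 / 2) ^ 2
      - 3 * c * (p.1 - p.2 + 1 / 2) ^ 2) = ∑' p, O p := by
    rw [← e0.tsum_eq O]
    refine tsum_congr fun p => ?_
    simp only [hO, e0, Equiv.coe_fn_mk]
    push_cast
    ring_nf
  have h1 : ∑' p : ℤ × ℤ, Real.exp (-c * (p.1 + p.2 + 1 + 1 / 2) ^ 2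
      - 3 * c * (p.1 - p.2 + 1 / 2) ^ 2) = ∑' p, O p := by
    rw [← e1.tsum_eq O]
    refine tsum_congr fun p => ?_
    simp only [hO, e1, Equiv.coe_fn_mk]
    push_cast
    ring_nf
  rw [h0, h1]
  ring

lemma shiftTheta_zero_modular {a : ℝ} (ha : 0 < a) :
    shiftTheta 0 (π * a) = 1 / a ^ (1 / 2 : ℝ) * shiftTheta 0 (π / a) := by
  have h := Real.tsum_exp_neg_mul_int_sq ha
  simp only [shiftTheta, add_zero]
  rw [tsum_congr fun n : ℤ => show Real.exp (-(π * a) * n ^ 2) = Real.exp (-π * a * n ^ 2) by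
    ring_nf, h, tsum_congr fun n : ℤ => show Real.exp (-π / a * n ^ 2)
    = Real.exp (-(π / a) * n ^ 2) by ring_nf]

lemma altTheta_modular {a : ℝ} (ha : 0 < a) :
    altTheta (π * a) = 1 / a ^ (1 / 2 : ℝ) * shiftTheta (1 / 2) (π / a) := by
  have h := Complex.tsum_exp_neg_quadratic (a := a) (by simpa using ha) (-Complex.I / 2)
  have h1 (n : ℤ) : Complex.exp (-π * a * n ^ 2 + 2 * π * (-Complex.I / 2) * n)
      = (((-1) ^ n * Real.exp (-(π * a) * n ^ 2) : ℝ) : ℂ) := by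
    rw [Complex.exp_add, show 2 * π * (-Complex.I / 2) * n = n * -(π * Complex.I) by ring,
      Complex.exp_int_mul, Complex.exp_neg, Complex.exp_pi_mul_I]
    push_cast
    rw [mul_comm, inv_neg, inv_one]
    ring_nf
  have h2 (n : ℤ) : Complex.exp (-π / a * (n + Complex.I * (-Complex.I / 2)) ^ 2)
      = ((Real.exp (-(π / a) * (n + 1 / 2) ^ 2) : ℝ) : ℂ) := by
    rw [show Complex.I * (-Complex.I / 2) = 1 / 2 by
      rw [mul_div_assoc', mul_neg, Complex.I_mul_I, neg_neg]]
    push_cast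
    ring_nf
  simp only [h1, h2, ← Complex.ofReal_tsum] at h
  rw [show (1 / 2 : ℂ) = ((1 / 2 : ℝ) : ℂ) by push_cast; rfl, ← Complex.ofReal_cpow ha.le] at h
  unfold altTheta shiftTheta
  exact_mod_cast h

lemma exp_zpow_eq_exp_mul (x : ℝ) (n : ℤ) : Real.exp x ^ n = Real.exp (x * n) := by
  rw [Real.exp_mul, Real.rpow_intCast]

lemma exp_neg_zpow_sq (c : ℝ) (n : ℤ) : Real.exp (-c) ^ (n ^ 2) = Real.exp (-c * n ^ 2) := by
  rw [exp_zpow_eq_exp_mul]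
  push_cast
  rfl

open Filter Topology in
/-- The theta series at nome `exp (-c)` determine the product of `1 - exp (-c (2 k + 1))`. -/
lemma exp_tsum_log_pow_six {c : ℝ} (hc : 0 < c) :
    Real.exp (∑' k : ℕ, Real.log (1 - Real.exp (-(c * (2 * k + 1))))) ^ 6
        * (shiftTheta (1 / 2) c * shiftTheta 0 c)
      = 2 * Real.exp (-c / 4) * altTheta c ^ 2 := by
  set q := Real.exp (-c) with hq
  have hq0 : 0 < q := Real.exp_pos _
  have hq1 : q < 1 := Real.exp_lt_one_iff.2 (by linarith)
  obtain ⟨P, hP, hPt⟩ := exists_tendsto_evenProd hq0 hq1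
  have hodd : Summable fun j : ℕ => q ^ (2 * j + 1) :=
    (summable_geometric_of_lt_one hq0.le hq1).comp_injective
      (i := fun j : ℕ => 2 * j + 1) (fun a b h => by simpa using h)
  have heven : Summable fun j : ℕ => q ^ (2 * j + 2) :=
    (summable_geometric_of_lt_one hq0.le hq1).comp_injective
      (i := fun j : ℕ => 2 * j + 2) (fun a b h => by simpa using h)
  have hA := tendsto_prod_one_add hodd.neg fun j => by
    rw [← sub_eq_add_neg]; exact one_sub_pow_pos hq0 hq1 (2 * j)
  have hB := tendsto_prod_one_add hodd fun j => by positivity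
  have hC := tendsto_prod_one_add heven fun j => by positivity
  have hA' : ∑' k : ℕ, Real.log (1 - Real.exp (-(c * (2 * k + 1))))
      = ∑' j : ℕ, Real.log (1 + -q ^ (2 * j + 1)) := by
    refine tsum_congr fun k => ?_
    rw [hq, ← Real.exp_nat_mul, sub_eq_add_neg]
    push_cast
    ring_nf
  rw [hA']
  set A := Real.exp (∑' j : ℕ, Real.log (1 + -q ^ (2 * j + 1)))
  set B := Real.exp (∑' j : ℕ, Real.log (1 + q ^ (2 * j + 1)))
  set C := Real.exp (∑' j : ℕ, Real.log (1 + q ^ (2 * j + 2)))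
  have hABC : A * B * C = 1 := by
    have h1 := hPt.mul ((hA.mul hB).mul hC)
    have h2 := hPt.comp (tendsto_id.const_mul_atTop' (two_pos : 0 < 2))
    have h3 := tendsto_nhds_unique h1 (h2.congr fun N => by
      simp only [Function.comp_apply, id]
      induction N with
      | zero => simp [evenProd]
      | succ N ih =>
        rw [show 2 * (N + 1) = 2 * N + 1 + 1 by ring, evenProd, evenProd] at *
        rw [Finset.prod_range_succ, Finset.prod_range_succ, ih]
        simp only [Finset.prod_range_succ]
        ring)
    exact mul_left_cancel₀ hP.ne' (h3.trans (mul_one P).symm)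
  have hZ : shiftTheta 0 c = P * B ^ 2 := by
    have e (n : ℤ) : q ^ (n ^ 2) * 1 ^ n = Real.exp (-c * (n + 0) ^ 2) := by
      rw [one_zpow, mul_one, add_zero, exp_neg_zpow_sq]
    have h := tendsto_triple_product hq0 hq1 one_ne_zero hP hPt
      ((summable_shiftTheta 0 hc).congr fun n => (e n).symm)
    have h2 := tendsto_nhds_unique h ((hB.mul hB).congr fun N => by
      rw [← Finset.prod_mul_distrib]; simp)
    rw [tsum_congr e, inv_mul_eq_iff_eq_mul₀ hP.ne'] at h2
    rw [shiftTheta, h2, sq]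
  have hY : altTheta c = P * A ^ 2 := by
    have e (n : ℤ) : q ^ (n ^ 2) * (-1) ^ n = (-1) ^ n * Real.exp (-c * n ^ 2) := by
      rw [mul_comm, exp_neg_zpow_sq]
    have h := tendsto_triple_product hq0 hq1 (neg_ne_zero.2 one_ne_zero) hP hPt
      ((summable_altTheta hc).congr fun n => (e n).symm)
    have h2 := tendsto_nhds_unique h ((hA.mul hA).congr fun N => by
      rw [← Finset.prod_mul_distrib]; simp [inv_neg])
    rw [tsum_congr e, inv_mul_eq_iff_eq_mul₀ hP.ne'] at h2
    rw [altTheta, h2, sq]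
  have hX : shiftTheta (1 / 2) c = 2 * Real.exp (-c / 4) * (P * C ^ 2) := by
    have e (n : ℤ) : q ^ (n ^ 2) * q ^ n
        = Real.exp (c / 4) * Real.exp (-c * (n + 1 / 2) ^ 2) := by
      rw [exp_neg_zpow_sq, hq, exp_zpow_eq_exp_mul, ← Real.exp_add, ← Real.exp_add]
      ring_nf
    have h := tendsto_triple_product hq0 hq1 hq0.ne' hP hPt
      (((summable_shiftTheta (1 / 2) hc).mul_left _).congr fun n => (e n).symm)
    have h0 : Tendsto (fun N : ℕ => 1 + q ^ (2 * N)) atTop (𝓝 (1 + 0)) :=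
      ((tendsto_pow_atTop_nhds_zero_of_lt_one hq0.le hq1).comp
        (tendsto_id.const_mul_atTop' (two_pos : 0 < 2))).const_add 1
    have h2 := tendsto_nhds_unique (h.mul h0) (((hC.mul hC).const_mul 2).congr fun N => by
      have e1 : ∏ j ∈ Finset.range N, (1 + q⁻¹ * q ^ (2 * j + 1))
          = ∏ j ∈ Finset.range N, (1 + q ^ (2 * j)) :=
        Finset.prod_congr rfl fun j _ => by rw [pow_succ']; field_simp
      have e2 : ∏ j ∈ Finset.range N, (1 + q * q ^ (2 * j + 1))
          = ∏ j ∈ Finset.range N, (1 + q ^ (2 * j + 2)) :=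
        Finset.prod_congr rfl fun j _ => by ring
      have e3 := (Finset.prod_range_succ (fun j => 1 + q ^ (2 * j)) N).symm.trans
        (Finset.prod_range_succ' (fun j => 1 + q ^ (2 * j)) N)
      simp only [mul_add, mul_one, mul_zero, pow_zero] at e3
      rw [Finset.prod_mul_distrib, e1, e2]
      linear_combination -(∏ j ∈ Finset.range N, (1 + q ^ (2 * j + 2))) * e3)
    rw [tsum_congr e, tsum_mul_left, ← shiftTheta, add_zero, mul_one,
      inv_mul_eq_iff_eq_mul₀ hP.ne'] at h2
    have h3 : Real.exp (-c / 4) * Real.exp (c / 4) = 1 := by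
      rw [← Real.exp_add, neg_div, neg_add_cancel, Real.exp_zero]
    linear_combination Real.exp (-c / 4) * h2 - shiftTheta (1 / 2) c * h3
  rw [hX, hY, hZ]
  linear_combination 2 * Real.exp (-c / 4) * P ^ 2 * A ^ 4 * (A * B * C + 1) * hABC

/-- The ratio of theta constants at the nome `exp (-π √3)`. -/
lemma altTheta_sq_pi_sqrt_three :
    altTheta (π * √3) ^ 2 = (2 + √3) * shiftTheta (1 / 2) (π * √3) ^ 2
      ∧ shiftTheta 0 (π * √3) ^ 2 = 2 * (shiftTheta (1 / 2) (π * √3) * altTheta (π * √3)) := by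
  have hr : 0 < √3 := by positivity
  have hrr : √3 * √3 = 3 := Real.mul_self_sqrt (by norm_num)
  have hc0 : 0 < π / √3 := by positivity
  have h3c : 3 * (π / √3) = π * √3 := by
    field_simp
    linarith
  have hcc : π * (√3)⁻¹ = π / √3 := rfl
  have hcc' : π / (√3)⁻¹ = π * √3 := by rw [div_inv_eq_mul]
  set t : ℝ := √3 ^ (1 / 2 : ℝ) with ht
  have htpos : 0 < t := by positivity
  have htt : t ^ 2 = √3 := by
    rw [ht, ← Real.rpow_natCast, ← Real.rpow_mul hr.le]; norm_num
  have hti : 1 / (√3)⁻¹ ^ (1 / 2 : ℝ) = t := by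
    rw [Real.inv_rpow hr.le, one_div, inv_inv]
  have hZ := shiftTheta_zero_modular (inv_pos.2 hr)
  have hX := altTheta_modular (inv_pos.2 hr)
  have hY := altTheta_modular hr
  rw [hcc, hcc', hti] at hZ hX
  rw [← ht] at hY
  have hd := shiftTheta_zero_mul_three hc0
  have hq := shiftTheta_zero_pow_four (c := π * √3) (by positivity)
  have hle : shiftTheta (1 / 2) (π * √3)
      ≤ Real.exp (-(π / √3) / 2) * shiftTheta (1 / 2) (π / √3) := by
    unfold shiftTheta
    rw [← tsum_mul_left]
    refine (summable_shiftTheta _ (by positivity)).tsum_le_tsum (fun n => ?_)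
      ((summable_shiftTheta _ hc0).mul_left _)
    rw [← Real.exp_add, Real.exp_le_exp, ← h3c]
    have hn : (1 / 4 : ℝ) ≤ (n + 1 / 2) ^ 2 := by
      have : (0 : ℤ) ≤ n * (n + 1) := by
        rcases le_or_gt 0 n with h | h
        · positivity
        · nlinarith
      have : (0 : ℝ) ≤ n * (n + 1) := by exact_mod_cast this
      linarith
    nlinarith
  have hXp := shiftTheta_pos (1 / 2) (c := π * √3) (by positivity)
  have hZp := shiftTheta_pos 0 (c := π * √3) (by positivity)
  have hX0p := shiftTheta_pos (1 / 2) hc0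
  rw [h3c] at hd
  set X := shiftTheta (1 / 2) (π * √3)
  set Y := altTheta (π * √3)
  set Z := shiftTheta 0 (π * √3)
  set X0 := shiftTheta (1 / 2) (π / √3)
  have hX0 : X0 = t * Y := by rw [hY]; field_simp
  have hYp : 0 < Y := by rw [hY]; positivity
  rw [hZ, hX, hX0] at hd
  have hd' : Z ^ 2 = 2 * (X * Y) := mul_left_cancel₀ htpos.ne' (by linear_combination hd)
  have hlt : X < Y := by
    refine hle.trans_lt ?_
    rw [hX0, ← mul_assoc]
    refine mul_lt_of_lt_one_left hYp ?_
    have h4 : (Real.exp (-(π / √3) / 2) * t) ^ 4 < 1 := by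
      have e1 : (Real.exp (-(π / √3) / 2) * t) ^ 4 = Real.exp (-(2 * (π / √3))) * 3 := by
        rw [mul_pow, ← Real.exp_nat_mul, show t ^ 4 = (t ^ 2) * (t ^ 2) by ring, htt, hrr]
        push_cast
        ring_nf
      rw [e1, Real.exp_neg, inv_mul_lt_iff₀ (Real.exp_pos _), mul_one]
      have := Real.add_one_le_exp (2 * (π / √3))
      have h1 : 1 < π / √3 := by
        rw [one_lt_div hr]
        nlinarith [Real.pi_gt_three]
      linarith
    by_contra! h
    exact absurd h4 (not_lt.2 (one_le_pow₀ h))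
  refine ⟨?_, hd'⟩
  have hquad : (Y ^ 2 - (2 + √3) * X ^ 2) * (Y ^ 2 - (2 - √3) * X ^ 2) = 0 := by
    linear_combination -hq + (Z ^ 2 + 2 * (X * Y)) * hd' - X ^ 4 * hrr
  rcases mul_eq_zero.1 hquad with h | h
  · linarith
  · have : 1 < √3 := by nlinarith
    nlinarith

lemma tsum_log_cosLogZero_sqrt_three :
    ∑' k, Real.log (cosLogZero √3 k)
      = (6 * Real.log (1 + √3) - Real.log 2 - π * √3) / 24 := by
  have h6 := exp_tsum_log_pow_six (c := π * √3) (by positivity)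
  obtain ⟨h1, h2⟩ := altTheta_sq_pi_sqrt_three
  have hrr : √3 * √3 = 3 := Real.mul_self_sqrt (by norm_num)
  have hXp := shiftTheta_pos (1 / 2) (c := π * √3) (by positivity)
  unfold cosLogZero
  set S := ∑' k : ℕ, Real.log (1 - Real.exp (-(π * √3 * (2 * k + 1))))
  set X := shiftTheta (1 / 2) (π * √3)
  set Y := altTheta (π * √3)
  set Z := shiftTheta 0 (π * √3)
  have hY : Y ≠ 0 := by
    intro h
    rw [h] at h1
    have : 0 < (2 + √3) * X ^ 2 := by positivity
    linarith
  have h12 : Real.exp S ^ 12 * X ^ 3 = 2 * Real.exp (-(π * √3) / 4) ^ 2 * Y ^ 3 := by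
    refine mul_left_cancel₀ (mul_ne_zero two_ne_zero hY) ?_
    linear_combination (Real.exp S ^ 6 * (X * Z)
      + 2 * Real.exp (-(π * √3) / 4) * Y ^ 2) * h6 - Real.exp S ^ 12 * X ^ 2 * h2
  have h24 : Real.exp S ^ 24 * 2 = Real.exp (-(π * √3) / 4) ^ 4 * (1 + √3) ^ 6 := by
    refine mul_right_cancel₀ (pow_ne_zero 6 hXp.ne') ?_
    have e1 : Y ^ 6 = (2 + √3) ^ 3 * X ^ 6 := by
      linear_combination (Y ^ 4 + Y ^ 2 * ((2 + √3) * X ^ 2) + ((2 + √3) * X ^ 2) ^ 2) * h1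
    have e2 : (1 + √3) ^ 6 = 8 * (2 + √3) ^ 3 := by
      have : (1 + √3) ^ 2 = 2 * (2 + √3) := by linear_combination hrr
      rw [show (1 + √3) ^ 6 = ((1 + √3) ^ 2) ^ 3 by ring, this]
      ring
    rw [e2]
    linear_combination 2 * (Real.exp S ^ 12 * X ^ 3
      + 2 * Real.exp (-(π * √3) / 4) ^ 2 * Y ^ 3) * h12
      + 8 * Real.exp (-(π * √3) / 4) ^ 4 * e1
  have hl := congrArg Real.log h24
  rw [Real.log_mul (by positivity) (by norm_num), Real.log_mul (by positivity) (by positivity),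
    Real.log_pow, Real.log_pow, Real.log_pow, Real.log_exp, Real.log_exp] at hl
  push_cast at hl
  linarith

theorem stmt_7 :
    ∫ x in (0:ℝ)..(π/2),
        Real.log (Real.cosh (x / Real.sqrt 3) + Real.cos (Real.log (2 * Real.cos x) / Real.sqrt 3))
      = π^2 / (8 * Real.sqrt 3) - (π/4) * Real.log (1 + Real.sqrt 3) + (13 * π / 24) * Real.log 2 := by
  have hrr : √3 * √3 = 3 := Real.mul_self_sqrt (by norm_num)
  have hr : 0 < √3 := by positivity
  rw [integral_log_cosh_add_cos (Real.one_le_sqrt.2 (by norm_num)), tsum_log_cosLogZero_sqrt_three]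
  have : π ^ 2 / (8 * √3) = π ^ 2 * √3 / 24 := by
    field_simp
    linear_combination -8 * hrr
  rw [this]
  ring
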